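/- arXiv:1905.01414 — 2 statements merged into one kernel-verified Lean document; each statement's English description precedes it below -/
import Mathlib

section
/- Let R₁ = ℂ[α₁, γ₁, γ₂] and R₂ = ℂ[β₂, β₃], both S₃-stable subalgebras of Q^{U_n}, and let m : R₁ ⊗ R₂ → Q^{U_n} be the linear map determined by m(f ⊗ g) = fg, where S₃ acts diagonally on R₁ ⊗ R₂. Then m is a surjective S₃-equivariant linear map and m((R₁ ⊗ R₂)^{S₃}) = (Q^{U_n})^{S₃}. -/
open MvPolynomial

noncomputable section

/-- The polynomial ring `𝒫 = ℂ[x_{ij} : 1 ≤ i ≤ n, 1 ≤ j ≤ 3]` in the entries of an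
`n × 3` matrix of indeterminates. -/
abbrev P (n : ℕ) : Type := MvPolynomial (Fin n × Fin 3) ℂ

/-- The action of a matrix `g` on `𝒫`, given by `(g · f)(X) = f(gᵀ X)`;
on variables it sends `x_{ij} ↦ ∑ s g_{si} x_{sj}`. -/
def matAct (n : ℕ) (g : Matrix (Fin n) (Fin n) ℂ) : P n →ₐ[ℂ] P n :=
  aeval fun p : Fin n × Fin 3 => ∑ s : Fin n, C (g s p.1) * X (s, p.2)

/-- The action of `σ ∈ S₃` permuting columns: `x_{ij} ↦ x_{iσ(j)}`. -/
def permAct (n : ℕ) (σ : Equiv.Perm (Fin 3)) : P n →ₐ[ℂ] P n :=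
  aeval fun p : Fin n × Fin 3 => X (p.1, σ p.2)

/-- `g` is upper triangular with all diagonal entries equal to `1`, i.e. `g ∈ U_n`. -/
def IsUpperUni (n : ℕ) (g : Matrix (Fin n) (Fin n) ℂ) : Prop :=
  (∀ i, g i i = 1) ∧ ∀ i j, j < i → g i j = 0

/-- `f` is `U_n`-invariant. -/
def UInv (n : ℕ) (f : P n) : Prop :=
  ∀ g : Matrix (Fin n) (Fin n) ℂ, IsUpperUni n g → matAct n g f = f

/-- `f ∈ Q_m` : each monomial of `f` has total degree `m` in the column-`j` variables,
for each `j`. -/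
def InQm (n m : ℕ) (f : P n) : Prop :=
  ∀ d ∈ f.support, ∀ j : Fin 3, (∑ i : Fin n, d (i, j)) = m

/-- `f ∈ Q = ⊕ₘ Q_m` : each monomial of `f` has equal total degree in the three columns. -/
def InQ (n : ℕ) (f : P n) : Prop :=
  ∀ d ∈ f.support, ∀ j : Fin 3, (∑ i : Fin n, d (i, j)) = ∑ i : Fin n, d (i, (0 : Fin 3))

/-- The variable `x_{(i+1)(j+1)}`, `i j : Fin 3` (0-indexed rows and columns). -/
def Xe (n : ℕ) (hn : 3 ≤ n) (i j : Fin 3) : P n := X (Fin.castLE hn i, j)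

/-- `δ_{ij} = x_{1i} x_{2j} - x_{2i} x_{1j}` (0-indexed columns `i j : Fin 3`). -/
def del (n : ℕ) (hn : 3 ≤ n) (i j : Fin 3) : P n :=
  Xe n hn 0 i * Xe n hn 1 j - Xe n hn 1 i * Xe n hn 0 j

/-- `α₁ = x₁₁ x₁₂ x₁₃`. -/
def alpha1 (n : ℕ) (hn : 3 ≤ n) : P n := Xe n hn 0 0 * Xe n hn 0 1 * Xe n hn 0 2

/-- `β₂ = x₁₂ δ₁₃`. -/
def beta2 (n : ℕ) (hn : 3 ≤ n) : P n := Xe n hn 0 1 * del n hn 0 2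

/-- `β₃ = x₁₃ δ₁₂`. -/
def beta3 (n : ℕ) (hn : 3 ≤ n) : P n := Xe n hn 0 2 * del n hn 0 1

/-- `γ₁ = det (x_{ij})_{1 ≤ i,j ≤ 3}`. -/
def gamma1 (n : ℕ) (hn : 3 ≤ n) : P n := Matrix.det (Matrix.of fun i j : Fin 3 => Xe n hn i j)

/-- `γ₂ = δ₁₂ δ₁₃ δ₂₃`. -/
def gamma2 (n : ℕ) (hn : 3 ≤ n) : P n := del n hn 0 1 * del n hn 0 2 * del n hn 1 2

/-- `α₂ = β₂² + β₃² − β₂ β₃`. -/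
def alpha2 (n : ℕ) (hn : 3 ≤ n) : P n := beta2 n hn ^ 2 + beta3 n hn ^ 2 - beta2 n hn * beta3 n hn

/-- `α₃ = 2(β₂³ + β₃³) − 3(β₂² β₃ + β₂ β₃²)`. -/
def alpha3 (n : ℕ) (hn : 3 ≤ n) : P n :=
  2 * (beta2 n hn ^ 3 + beta3 n hn ^ 3) -
    3 * (beta2 n hn ^ 2 * beta3 n hn + beta2 n hn * beta3 n hn ^ 2)

open scoped TensorProduct

set_option synthInstance.maxHeartbeats 1000000
set_option maxHeartbeats 2000000

/-- `R₁ = ℂ[α₁, γ₁, γ₂]`. -/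
def R1 (n : ℕ) (hn : 3 ≤ n) : Subalgebra ℂ (P n) :=
  Algebra.adjoin ℂ {alpha1 n hn, gamma1 n hn, gamma2 n hn}

/-- `R₂ = ℂ[β₂, β₃]`. -/
def R2 (n : ℕ) (hn : 3 ≤ n) : Subalgebra ℂ (P n) :=
  Algebra.adjoin ℂ {beta2 n hn, beta3 n hn}

/-- The multiplication map `m : R₁ ⊗ R₂ → 𝒫`, `f ⊗ g ↦ fg`. -/
def mMap (n : ℕ) (hn : 3 ≤ n) : R1 n hn ⊗[ℂ] R2 n hn →ₗ[ℂ] P n :=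
  (LinearMap.mul' ℂ (P n)).comp
    (TensorProduct.map (R1 n hn).val.toLinearMap (R2 n hn).val.toLinearMap)

/-- The canonical (injective) map `R₁ ⊗ R₂ → 𝒫 ⊗ 𝒫`. -/
def iotaMap (n : ℕ) (hn : 3 ≤ n) : R1 n hn ⊗[ℂ] R2 n hn →ₗ[ℂ] P n ⊗[ℂ] P n :=
  TensorProduct.map (R1 n hn).val.toLinearMap (R2 n hn).val.toLinearMap

/-- The diagonal action of `σ ∈ S₃` on `𝒫 ⊗ 𝒫`. -/
def tenAct (n : ℕ) (σ : Equiv.Perm (Fin 3)) : P n ⊗[ℂ] P n →ₗ[ℂ] P n ⊗[ℂ] P n :=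
  TensorProduct.map (permAct n σ).toLinearMap (permAct n σ).toLinearMap

section GeneralPolynomial

variable {σ R : Type*} [CommRing R]

/-- The endomorphism of a polynomial ring substituting `L` for the variable `X i`. -/
def substVar [DecidableEq σ] (i : σ) (L : MvPolynomial σ R) :
    MvPolynomial σ R →ₐ[R] MvPolynomial σ R :=
  aeval (Function.update X i L)

@[simp]
theorem substVar_X_self [DecidableEq σ] (i : σ) (L : MvPolynomial σ R) :
    substVar i L (X i) = L := by
  simp [substVar]

theorem substVar_X_of_ne [DecidableEq σ] {i j : σ} (h : j ≠ i) (L : MvPolynomial σ R) :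
    substVar i L (X j) = X j := by
  simp [substVar, h]

theorem X_sub_dvd_sub_substVar [DecidableEq σ] (i : σ) (L F : MvPolynomial σ R) :
    X i - L ∣ F - substVar i L F := by
  induction F using MvPolynomial.induction_on with
  | C a => simp [substVar]
  | add p q hp hq =>
    rw [map_add, add_sub_add_comm]
    exact dvd_add hp hq
  | mul_X p j hp =>
    have hj : X i - L ∣ X j - substVar i L (X j) := by
      by_cases h : j = i
      · subst h
        simp
      · simp [substVar_X_of_ne h]
    rw [map_mul]
    have key := dvd_add (hp.mul_right (X j)) (hj.mul_left (substVar i L p))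
    convert key using 1
    ring

theorem eval_aeval_eq {τ : Type*} (x : τ → R) (g : σ → MvPolynomial τ R) (F : MvPolynomial σ R) :
    eval x (aeval g F) = eval (fun i => eval x (g i)) F :=
  eval₂Hom_bind₁ _ _ _ _

theorem eval_substVar [DecidableEq σ] (v : σ → R) (i : σ) (L F : MvPolynomial σ R) :
    eval v (substVar i L F) = eval (Function.update v i (eval v L)) F := by
  rw [substVar, eval_aeval_eq]
  refine congrArg (fun w => eval w F) (funext fun j => ?_)
  by_cases h : j = i
  · subst h
    simp
  · simp [h]

theorem X_sub_dvd_of_substVar_eq_zero [DecidableEq σ] {i : σ} {L F : MvPolynomial σ R}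
    (h : substVar i L F = 0) : X i - L ∣ F := by
  have := X_sub_dvd_sub_substVar i L F
  rwa [h, sub_zero] at this

theorem eq_zero_of_eval_eq_zero_of_ne [IsDomain R] [Infinite R] (F q : MvPolynomial σ R)
    (hq : q ≠ 0) (h : ∀ v, eval v q ≠ 0 → eval v F = 0) : F = 0 := by
  have : q * F = 0 := by
    apply MvPolynomial.funext
    intro v
    by_cases hv : eval v q = 0
    · simp [hv]
    · simp [h v hv]
  exact (mul_eq_zero.mp this).resolve_left hq

end GeneralPolynomial

/-- The generators `α₁, β₂, β₃, γ₁, γ₂` of the invariant algebra `Q^{U_n}`. -/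
def invGen (n : ℕ) (hn : 3 ≤ n) : Fin 5 → P n :=
  ![alpha1 n hn, beta2 n hn, beta3 n hn, gamma1 n hn, gamma2 n hn]

/-- The subalgebra of `𝒫` generated by `α₁, β₂, β₃, γ₁, γ₂`. -/
def invAlg (n : ℕ) (hn : 3 ≤ n) : Subalgebra ℂ (P n) :=
  (aeval (invGen n hn) : MvPolynomial (Fin 5) ℂ →ₐ[ℂ] P n).range

section InvariantAlgebra

variable {n : ℕ} {hn : 3 ≤ n}

theorem invGen_mem_invAlg (i : Fin 5) : invGen n hn i ∈ invAlg n hn :=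
  ⟨X i, by simp⟩

theorem alpha1_mul_gamma2 :
    alpha1 n hn * gamma2 n hn =
      beta2 n hn * beta3 n hn * (beta2 n hn - beta3 n hn) := by
  simp only [alpha1, gamma2, beta2, beta3, del]
  ring

theorem invGen_zero_mul_invGen_four :
    invGen n hn 0 * invGen n hn 4 =
      invGen n hn 1 * invGen n hn 2 * (invGen n hn 1 - invGen n hn 2) :=
  alpha1_mul_gamma2

/-- The point of the space of `n × 3` matrices with upper `3 × 3` block `M` and all other
entries equal to zero. -/
def blockPoint (n : ℕ) (M : Matrix (Fin 3) (Fin 3) ℂ) : Fin n × Fin 3 → ℂ :=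
  fun p => if h : p.1.val < 3 then M ⟨p.1.val, h⟩ p.2 else 0

@[simp]
theorem eval_blockPoint_Xe (M : Matrix (Fin 3) (Fin 3) ℂ) (i j : Fin 3) :
    eval (blockPoint n M) (Xe n hn i j) = M i j := by
  simp [Xe, blockPoint]

theorem eval_blockPoint_invGen (M : Matrix (Fin 3) (Fin 3) ℂ) :
    (fun i => eval (blockPoint n M) (invGen n hn i)) =
      ![M 0 0 * M 0 1 * M 0 2,
        M 0 1 * (M 0 0 * M 1 2 - M 1 0 * M 0 2),
        M 0 2 * (M 0 0 * M 1 1 - M 1 0 * M 0 1),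
        M.det,
        (M 0 0 * M 1 1 - M 1 0 * M 0 1) * (M 0 0 * M 1 2 - M 1 0 * M 0 2) *
          (M 0 1 * M 1 2 - M 1 1 * M 0 2)] := by
  funext i
  fin_cases i <;>
    simp [invGen, alpha1, beta2, beta3, gamma1, gamma2, del, Matrix.det_fin_three]

/-- If `a` times a polynomial lies in the invariant algebra, the defining polynomial vanishes
at every value of the generators attained at a zero of `a`. -/
theorem eval_eq_zero_of_mul_eq {a h : P n} {F : MvPolynomial (Fin 5) ℂ}
    (hF : aeval (invGen n hn) F = a * h) {x : Fin n × Fin 3 → ℂ} {v : Fin 5 → ℂ}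
    (hv : (fun i => eval x (invGen n hn i)) = v) (ha : eval x a = 0) : eval v F = 0 := by
  rw [← hv, ← eval_aeval_eq, hF, map_mul, ha, zero_mul]

theorem alpha1_ne_zero : alpha1 n hn ≠ 0 := by
  simp [alpha1, Xe]

theorem beta3_ne_zero : beta3 n hn ≠ 0 := by
  intro h
  have := congrArg (eval (blockPoint n !![1, 0, 1; 0, 1, 0; 0, 0, 0])) h
  simp [beta3, del] at this

theorem gamma1_ne_zero : gamma1 n hn ≠ 0 := by
  intro h
  have := congrArg (eval (blockPoint n 1)) h
  simp [gamma1, Matrix.det_fin_three] at this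

theorem mem_invAlg_of_alpha1_mul_mem {h : P n} (H : alpha1 n hn * h ∈ invAlg n hn) :
    h ∈ invAlg n hn := by
  obtain ⟨F, hF⟩ := H
  replace hF : aeval (invGen n hn) F = alpha1 n hn * h := hF
  obtain ⟨F₁, hF₁⟩ := X_sub_dvd_sub_substVar (0 : Fin 5) 0 F
  set F₀ := substVar 0 0 F with hF₀
  have h1 : substVar (1 : Fin 5) 0 F₀ = 0 := by
    refine eq_zero_of_eval_eq_zero_of_ne _ (X 2) (X_ne_zero 2) fun v hv => ?_
    rw [eval_X] at hv
    rw [hF₀, eval_substVar, eval_substVar]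
    refine eval_eq_zero_of_mul_eq hF
      (x := blockPoint n !![1, 0, 1; 0, v 2, -v 4 / v 2 ^ 2; 0, 0, v 3 / v 2]) ?_ ?_
    · rw [eval_blockPoint_invGen]
      funext i
      fin_cases i <;> simp [Matrix.det_fin_three, Function.update] <;> field_simp
    · simp [alpha1]
  have h2 : substVar (2 : Fin 5) 0 F₀ = 0 := by
    refine eq_zero_of_eval_eq_zero_of_ne _ (X 1) (X_ne_zero 1) fun v hv => ?_
    rw [eval_X] at hv
    rw [hF₀, eval_substVar, eval_substVar]
    refine eval_eq_zero_of_mul_eq hF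
      (x := blockPoint n !![1, 1, 0; 0, v 4 / v 1 ^ 2, v 1; 0, -v 3 / v 1, 0]) ?_ ?_
    · rw [eval_blockPoint_invGen]
      funext i
      fin_cases i <;> simp [Matrix.det_fin_three, Function.update] <;> field_simp
    · simp [alpha1]
  have h3 : substVar (1 : Fin 5) (X 2) F₀ = 0 := by
    refine eq_zero_of_eval_eq_zero_of_ne _ (X 2) (X_ne_zero 2) fun v hv => ?_
    rw [eval_X] at hv
    rw [hF₀, eval_substVar, eval_substVar]
    refine eval_eq_zero_of_mul_eq hF
      (x := blockPoint n !![0, 1, 1; -v 2, 0, v 4 / v 2 ^ 2; 0, 0, v 3 / v 2]) ?_ ?_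
    · rw [eval_blockPoint_invGen]
      funext i
      fin_cases i <;> simp [Matrix.det_fin_three, Function.update] <;> field_simp
    · simp [alpha1]
  obtain ⟨G, hG⟩ := X_sub_dvd_of_substVar_eq_zero h1
  rw [hG] at h2 h3
  have h2' : substVar (2 : Fin 5) 0 G = 0 := by
    simpa [X_ne_zero, substVar_X_of_ne] using h2
  obtain ⟨K, rfl⟩ := X_sub_dvd_of_substVar_eq_zero h2'
  have h3' : substVar (1 : Fin 5) (X 2) K = 0 := by
    simpa [X_ne_zero, substVar_X_of_ne] using h3
  obtain ⟨E, rfl⟩ := X_sub_dvd_of_substVar_eq_zero h3'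
  refine ⟨(F₁ + X 4 * E : MvPolynomial (Fin 5) ℂ), mul_left_cancel₀ (alpha1_ne_zero (hn := hn)) ?_⟩
  change invGen n hn 0 * aeval (invGen n hn) (F₁ + X 4 * E) = _
  rw [← hF, eq_add_of_sub_eq hF₁, hG]
  simp only [map_add, map_mul, map_sub, aeval_X, sub_zero]
  linear_combination aeval (invGen n hn) E * invGen_zero_mul_invGen_four (hn := hn)

theorem mem_invAlg_of_beta3_mul_mem {h : P n} (H : beta3 n hn * h ∈ invAlg n hn) :
    h ∈ invAlg n hn := by
  obtain ⟨F, hF⟩ := H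
  replace hF : aeval (invGen n hn) F = beta3 n hn * h := hF
  obtain ⟨F₁, hF₁⟩ := X_sub_dvd_sub_substVar (2 : Fin 5) 0 F
  set F₀ := substVar 2 0 F with hF₀
  have h0 : substVar (0 : Fin 5) 0 F₀ = 0 := by
    refine eq_zero_of_eval_eq_zero_of_ne _ (X 1) (X_ne_zero 1) fun v hv => ?_
    rw [eval_X] at hv
    rw [hF₀, eval_substVar, eval_substVar]
    refine eval_eq_zero_of_mul_eq hF
      (x := blockPoint n !![1, 1, 0; 0, v 4 / v 1 ^ 2, v 1; 0, -v 3 / v 1, 0]) ?_ ?_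
    · rw [eval_blockPoint_invGen]
      funext i
      fin_cases i <;> simp [Matrix.det_fin_three, Function.update] <;> field_simp
    · simp [beta3]
  have h4 : substVar (4 : Fin 5) 0 F₀ = 0 := by
    refine eq_zero_of_eval_eq_zero_of_ne _ (X 1) (X_ne_zero 1) fun v hv => ?_
    rw [eval_X] at hv
    rw [hF₀, eval_substVar, eval_substVar]
    refine eval_eq_zero_of_mul_eq hF
      (x := blockPoint n !![1, 1, v 0; 0, 0, v 1; v 3 / v 1, 0, 0]) ?_ ?_
    · rw [eval_blockPoint_invGen]
      funext i
      fin_cases i <;> simp [Matrix.det_fin_three, Function.update]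
      field_simp
    · simp [beta3, del]
  obtain ⟨G, hG⟩ := X_sub_dvd_of_substVar_eq_zero h0
  rw [hG] at h4
  have h4' : substVar (4 : Fin 5) 0 G = 0 := by
    simpa [X_ne_zero, substVar_X_of_ne] using h4
  obtain ⟨E, rfl⟩ := X_sub_dvd_of_substVar_eq_zero h4'
  refine ⟨(F₁ + X 1 * (X 1 - X 2) * E : MvPolynomial (Fin 5) ℂ), mul_left_cancel₀ (beta3_ne_zero (hn := hn)) ?_⟩
  change invGen n hn 2 * aeval (invGen n hn) (F₁ + X 1 * (X 1 - X 2) * E) = _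
  rw [← hF, eq_add_of_sub_eq hF₁, hG]
  simp only [map_add, map_mul, map_sub, aeval_X, sub_zero]
  linear_combination -aeval (invGen n hn) E * invGen_zero_mul_invGen_four (hn := hn)

theorem eval_matAct (g : Matrix (Fin n) (Fin n) ℂ) (x : Fin n × Fin 3 → ℂ) (f : P n) :
    eval x (matAct n g f) = eval (fun p => ∑ s, g s p.1 * x (s, p.2)) f := by
  rw [matAct, eval_aeval_eq]
  simp

/-- Clear the entries below position `(r, c)` by subtracting multiples of row `r`. -/
def elimBelow (r : Fin n) (c : Fin 3) (x : Fin n × Fin 3 → ℂ) : Fin n × Fin 3 → ℂ :=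
  fun p => if r < p.1 then x p - x (p.1, c) / x (r, c) * x (r, p.2) else x p

theorem UInv.eval_elimBelow {f : P n} (hf : UInv n f) (r : Fin n) (c : Fin 3)
    (x : Fin n × Fin 3 → ℂ) : eval (elimBelow r c x) f = eval x f := by
  classical
  set g : Matrix (Fin n) (Fin n) ℂ := fun s i =>
    (if s = i then 1 else 0) + if s = r then (if r < i then -(x (i, c) / x (r, c)) else 0) else 0
    with hg
  have hU : IsUpperUni n g := by
    refine ⟨fun i => ?_, fun i j hij => ?_⟩
    · by_cases h : i = r <;> simp [hg, h]
    · have h1 : i ≠ j := hij.ne'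
      by_cases h : i = r
      · subst h
        simp [hg, h1, hij.le]
      · simp [hg, h, h1]
  have key := congrArg (eval x) (hf g hU)
  rw [eval_matAct] at key
  refine Eq.trans ?_ key
  refine congrArg (fun v => eval v f) ?_
  funext p
  simp only [hg, add_mul, Finset.sum_add_distrib, ite_mul, one_mul, zero_mul,
    Finset.sum_ite_eq', Finset.mem_univ, if_true, elimBelow]
  split_ifs <;> ring

theorem InQ.eval_scale {f : P n} (hf : InQ n f) {t : Fin 3 → ℂ} (ht : ∏ j, t j = 1)
    (x : Fin n × Fin 3 → ℂ) : eval (fun p => x p * t p.2) f = eval x f := by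
  rw [eval_eq', eval_eq']
  refine Finset.sum_congr rfl fun d hd => ?_
  congr 1
  simp only [mul_pow, Finset.prod_mul_distrib]
  have : ∏ p : Fin n × Fin 3, t p.2 ^ d p = 1 := by
    rw [Fintype.prod_prod_type_right]
    simp only [Finset.prod_pow_eq_pow_sum, hf d hd]
    rw [Finset.prod_pow, ht, one_pow]
  rw [this, mul_one]

/-- The normal form, under row operations by `U_n` and column scalings of determinant one, of a
matrix at which `α₁`, `β₃` and `γ₁` do not vanish. -/
def normalForm (n : ℕ) (a b₂ b₃ c : ℂ) : Fin n × Fin 3 → ℂ :=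
  blockPoint n !![1, 1, a; 0, b₃ / a, b₂; 0, 0, a * c / b₃]

theorem elimBelow_of_le {r i : Fin n} (h : i ≤ r) (c j : Fin 3) (x : Fin n × Fin 3 → ℂ) :
    elimBelow r c x (i, j) = x (i, j) :=
  if_neg h.not_gt

theorem elimBelow_of_lt {r i : Fin n} (h : r < i) (c j : Fin 3) (x : Fin n × Fin 3 → ℂ) :
    elimBelow r c x (i, j) = x (i, j) - x (i, c) / x (r, c) * x (r, j) :=
  if_pos h

theorem elimBelow_pivot {r i : Fin n} (h : r < i) {c : Fin 3} {x : Fin n × Fin 3 → ℂ}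
    (hx : x (r, c) ≠ 0) : elimBelow r c x (i, c) = 0 := by
  rw [elimBelow_of_lt h, div_mul_cancel₀ _ hx, sub_self]

theorem eval_eq_eval_normalForm {f : P n} (hQ : InQ n f) (hU : UInv n f)
    (x : Fin n × Fin 3 → ℂ) (ha : eval x (alpha1 n hn) ≠ 0) (hb : eval x (beta3 n hn) ≠ 0)
    (hc : eval x (gamma1 n hn) ≠ 0) :
    eval x f = eval (normalForm n (eval x (alpha1 n hn)) (eval x (beta2 n hn))
      (eval x (beta3 n hn)) (eval x (gamma1 n hn))) f := by
  obtain ⟨k, rfl⟩ := Nat.exists_eq_add_of_le' hn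
  rw [← hU.eval_elimBelow 0 0 x, ← hU.eval_elimBelow 1 1, ← hU.eval_elimBelow 2 2]
  have c0 : Fin.castLE hn 0 = 0 := rfl
  have c1 : Fin.castLE hn 1 = 1 := rfl
  have c2 : Fin.castLE hn 2 = 2 := rfl
  simp only [alpha1, beta2, beta3, gamma1, del, Xe, Matrix.det_fin_three, Matrix.of_apply,
    c0, c1, c2, map_mul, map_add, map_sub, eval_X] at ha hb hc ⊢
  have h00 : x (0, 0) ≠ 0 := fun h => ha (by simp [h])
  have h01 : x (0, 1) ≠ 0 := fun h => ha (by simp [h])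
  have h02 : x (0, 2) ≠ 0 := fun h => ha (by simp [h])
  have hd : x (0, 0) * x (1, 1) - x (1, 0) * x (0, 1) ≠ 0 := fun h => hb (by simp [h])
  have l01 : (0 : Fin (k + 3)) < 1 := by simp
  have l12 : (1 : Fin (k + 3)) < 2 := by
    rw [Fin.lt_def, ← c1, ← c2]
    simp
  set y := elimBelow 0 0 x with hy
  have y11 : y (1, 1) = (x (0, 0) * x (1, 1) - x (1, 0) * x (0, 1)) / x (0, 0) := by
    rw [hy, elimBelow_of_lt l01]
    field_simp
  have y12 : y (1, 2) = (x (0, 0) * x (1, 2) - x (1, 0) * x (0, 2)) / x (0, 0) := by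
    rw [hy, elimBelow_of_lt l01]
    field_simp
  have y11_ne : y (1, 1) ≠ 0 := y11 ▸ div_ne_zero hd h00
  set z := elimBelow 1 1 y with hz
  have z22 : z (2, 2) = (x (0, 0) * x (1, 1) * x (2, 2) - x (0, 0) * x (1, 2) * x (2, 1) -
      x (0, 1) * x (1, 0) * x (2, 2) + x (0, 1) * x (1, 2) * x (2, 0) +
      x (0, 2) * x (1, 0) * x (2, 1) - x (0, 2) * x (1, 1) * x (2, 0)) /
      (x (0, 0) * x (1, 1) - x (1, 0) * x (0, 1)) := by
    rw [hz, elimBelow_of_lt l12, y11, y12, hy, elimBelow_of_lt (l01.trans l12),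
      elimBelow_of_lt (l01.trans l12)]
    have hd' : x (0, 0) * x (1, 1) - x (0, 1) * x (1, 0) ≠ 0 := by rwa [mul_comm (x (0, 1))]
    field_simp
    ring
  have z22_ne : z (2, 2) ≠ 0 := z22 ▸ div_ne_zero hc hd
  rw [← hQ.eval_scale (t := ![1 / x (0, 0), 1 / x (0, 1), x (0, 0) * x (0, 1)])
    (by simp [Fin.prod_univ_three]; field_simp)]
  refine congrArg (fun v => eval v f) ?_
  funext ⟨i, j⟩
  have z_zero {i : Fin (k + 3)} (hi : 1 < i) : z (i, 0) = 0 ∧ z (i, 1) = 0 := by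
    refine ⟨?_, elimBelow_pivot hi y11_ne⟩
    rw [hz, elimBelow_of_lt hi, hy, elimBelow_pivot (l01.trans hi) h00, elimBelow_pivot l01 h00]
    simp
  rcases lt_or_ge 2 i with h2 | h2
  · have hi : ¬ i.val < 3 := by
      rw [Fin.lt_def, ← c2] at h2
      simpa [Nat.lt_succ_iff] using h2
    have : elimBelow 2 2 z (i, j) = 0 := by
      rw [elimBelow_of_lt h2]
      obtain ⟨e0, e1⟩ := z_zero (l12.trans h2)
      obtain ⟨e0', e1'⟩ := z_zero l12
      fin_cases j <;> simp [e0, e1, e0', e1', z22_ne]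
    rw [this]
    simp [normalForm, blockPoint, hi]
  · rw [elimBelow_of_le h2]
    obtain rfl | rfl | rfl : i = 0 ∨ i = 1 ∨ i = 2 := by
      rw [Fin.le_def, ← c2] at h2
      rw [← c0, ← c1, ← c2]
      simp only [Fin.ext_iff, Fin.val_castLE, Fin.val_zero, Fin.val_one, Fin.val_two] at h2 ⊢
      omega
    all_goals simp only [← c0, ← c1, ← c2, normalForm, blockPoint, Fin.val_castLE, Fin.is_lt,
      dif_pos, Fin.eta]
    · rw [c0, hz, elimBelow_of_le l01.le, hy, elimBelow_of_le le_rfl]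
      fin_cases j
      · simp [h00]
      · simp [h01]
      · simp
        ring
    · rw [c0, c1, hz, elimBelow_of_le le_rfl]
      fin_cases j
      · simp [hy, elimBelow_pivot l01 h00]
      · simp [y11]
        field_simp
      · simp [y12]
        field_simp
    · rw [c0, c1, c2]
      fin_cases j
      · simp [(z_zero l12).1]
      · simp [(z_zero l12).2]
      · simp [z22]
        field_simp

theorem exists_mem_invAlg_eval_normalForm (hn : 3 ≤ n) (f : P n) :
    ∃ N : ℕ, ∃ F ∈ invAlg n hn, ∀ x : Fin n × Fin 3 → ℂ,
      eval x (alpha1 n hn) ≠ 0 → eval x (beta3 n hn) ≠ 0 →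
      eval x F = eval x (alpha1 n hn * beta3 n hn) ^ N *
        eval (normalForm n (eval x (alpha1 n hn)) (eval x (beta2 n hn))
          (eval x (beta3 n hn)) (eval x (gamma1 n hn))) f := by
  have hα : alpha1 n hn ∈ invAlg n hn := invGen_mem_invAlg 0
  have hβ₂ : beta2 n hn ∈ invAlg n hn := invGen_mem_invAlg 1
  have hβ₃ : beta3 n hn ∈ invAlg n hn := invGen_mem_invAlg 2
  have hγ : gamma1 n hn ∈ invAlg n hn := invGen_mem_invAlg 3
  induction f using MvPolynomial.induction_on with
  | C a =>
    refine ⟨0, C a, (invAlg n hn).algebraMap_mem a, fun x _ _ => ?_⟩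
    simp
  | add p q hp hq =>
    obtain ⟨N, F, hF, hpF⟩ := hp
    obtain ⟨M, G, hG, hqG⟩ := hq
    refine ⟨N + M, F * (alpha1 n hn * beta3 n hn) ^ M + G * (alpha1 n hn * beta3 n hn) ^ N,
      add_mem (mul_mem hF (pow_mem (mul_mem hα hβ₃) _))
        (mul_mem hG (pow_mem (mul_mem hα hβ₃) _)), fun x ha hb => ?_⟩
    simp only [map_add, map_mul, map_pow, hpF x ha hb, hqG x ha hb]
    ring
  | mul_X p k hp =>
    obtain ⟨N, F, hF, hpF⟩ := hp
    obtain ⟨G, hG, hGx⟩ : ∃ G ∈ invAlg n hn, ∀ x : Fin n × Fin 3 → ℂ,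
        eval x (alpha1 n hn) ≠ 0 → eval x (beta3 n hn) ≠ 0 →
        eval x G = eval x (alpha1 n hn * beta3 n hn) *
          normalForm n (eval x (alpha1 n hn)) (eval x (beta2 n hn))
            (eval x (beta3 n hn)) (eval x (gamma1 n hn)) k := by
      obtain ⟨i, j⟩ := k
      by_cases hi : i.val < 3
      · obtain ⟨i, rfl⟩ : ∃ i' : Fin 3, i = Fin.castLE hn i' := ⟨⟨i, hi⟩, rfl⟩
        refine ⟨alpha1 n hn * beta3 n hn * !![1, 1, alpha1 n hn; 0, 0, beta2 n hn; 0, 0, 0] i j +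
          !![0, 0, 0; 0, beta3 n hn ^ 2, 0; 0, 0, alpha1 n hn ^ 2 * gamma1 n hn] i j,
          ?_, fun x ha hb => ?_⟩
        · refine add_mem (mul_mem (mul_mem hα hβ₃) ?_) ?_
          · fin_cases i <;> fin_cases j <;> simp [hα, hβ₂, zero_mem, one_mem]
          · fin_cases i <;> fin_cases j <;>
              simp [hα, hβ₃, hγ, pow_mem, mul_mem, zero_mem]
        · fin_cases i <;> fin_cases j <;> simp [normalForm, blockPoint] <;> field_simp
      · exact ⟨0, zero_mem _, fun x _ _ => by simp [normalForm, blockPoint, hi]⟩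
    refine ⟨N + 1, F * G, mul_mem hF hG, fun x ha hb => ?_⟩
    simp only [map_mul, hpF x ha hb, hGx x ha hb, eval_X]
    ring

theorem mem_invAlg_of_pow_mul_mem {f : P n} (N : ℕ)
    (H : (alpha1 n hn * beta3 n hn) ^ N * f ∈ invAlg n hn) : f ∈ invAlg n hn := by
  induction N with
  | zero => simpa using H
  | succ N ih =>
    refine ih (mem_invAlg_of_beta3_mul_mem (mem_invAlg_of_alpha1_mul_mem ?_))
    convert H using 1
    ring

theorem mem_invAlg_of_inQ_of_uInv {f : P n} (hQ : InQ n f) (hU : UInv n f) :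
    f ∈ invAlg n hn := by
  obtain ⟨N, F, hF, hx⟩ := exists_mem_invAlg_eval_normalForm hn f
  have key : (alpha1 n hn * beta3 n hn) ^ N * f - F = 0 := by
    refine eq_zero_of_eval_eq_zero_of_ne _ (alpha1 n hn * beta3 n hn * gamma1 n hn)
      (mul_ne_zero (mul_ne_zero alpha1_ne_zero beta3_ne_zero) gamma1_ne_zero) fun v hv => ?_
    simp only [map_mul, mul_ne_zero_iff] at hv
    rw [map_sub, hx v hv.1.1 hv.1.2, map_mul, map_pow,
      eval_eq_eval_normalForm hQ hU v hv.1.1 hv.1.2 hv.2, sub_self]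
  rw [← sub_eq_zero.mp key] at hF
  exact mem_invAlg_of_pow_mul_mem N hF

/-- The weight of a variable recording its column. -/
def colWeight (n : ℕ) (p : Fin n × Fin 3) : Fin 3 → ℕ := Pi.single p.2 1

theorem weight_colWeight (d : Fin n × Fin 3 →₀ ℕ) (j : Fin 3) :
    Finsupp.weight (colWeight n) d j = ∑ i, d (i, j) := by
  rw [Finsupp.weight_apply, Finsupp.sum_fintype _ _ (by simp), Finset.sum_apply,
    Fintype.sum_prod_type]
  simp [colWeight, Pi.single_apply]

theorem inQ_of_isWeightedHomogeneous {f : P n} {m : ℕ}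
    (hf : IsWeightedHomogeneous (colWeight n) f (fun _ => m)) : InQ n f := by
  intro d hd j
  rw [← weight_colWeight, ← weight_colWeight, hf (mem_support_iff.mp hd)]

/-- The subalgebra `Q` of `𝒫`. -/
def algQ (n : ℕ) : Subalgebra ℂ (P n) where
  carrier := {f | InQ n f}
  mul_mem' {f g} hf hg d hd j := by
    classical
    obtain ⟨a, ha, b, hb, rfl⟩ := Finset.mem_add.mp (support_mul f g hd)
    simp [Finset.sum_add_distrib, hf a ha j, hg b hb j]
  add_mem' {f g} hf hg d hd j := by
    classical
    rcases Finset.mem_union.mp (support_add hd) with h | h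
    · exact hf d h j
    · exact hg d h j
  algebraMap_mem' r := by
    refine inQ_of_isWeightedHomogeneous (m := 0) ?_
    exact isWeightedHomogeneous_C _ r

/-- The subalgebra of `U_n`-invariants of `𝒫`. -/
def algU (n : ℕ) : Subalgebra ℂ (P n) where
  carrier := {f | UInv n f}
  mul_mem' hf hg u hu := by rw [map_mul, hf u hu, hg u hu]
  add_mem' hf hg u hu := by rw [map_add, hf u hu, hg u hu]
  algebraMap_mem' r u _ := AlgHom.commutes _ r

theorem isWeightedHomogeneous_Xe (i j : Fin 3) :
    IsWeightedHomogeneous (colWeight n) (Xe n hn i j) (Pi.single j 1) :=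
  isWeightedHomogeneous_X _ _ _

theorem isWeightedHomogeneous_del (i j : Fin 3) :
    IsWeightedHomogeneous (colWeight n) (del n hn i j) (Pi.single i 1 + Pi.single j 1) :=
  ((isWeightedHomogeneous_Xe 0 i).mul (isWeightedHomogeneous_Xe 1 j)).sub
    ((isWeightedHomogeneous_Xe 1 i).mul (isWeightedHomogeneous_Xe 0 j))

theorem invGen_inQ (k : Fin 5) : InQ n (invGen n hn k) := by
  have of_eq {f : P n} {w : Fin 3 → ℕ} (m : ℕ) (hf : IsWeightedHomogeneous (colWeight n) f w)
      (hw : w = fun _ => m) : InQ n f := inQ_of_isWeightedHomogeneous (hw ▸ hf)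
  have X3 (a b c i j k : Fin 3) :=
    ((isWeightedHomogeneous_Xe (hn := hn) a i).mul (isWeightedHomogeneous_Xe (hn := hn) b j)).mul
      (isWeightedHomogeneous_Xe (hn := hn) c k)
  fin_cases k
  · exact of_eq 1 (X3 0 0 0 0 1 2) (by decide)
  · exact of_eq 1 ((isWeightedHomogeneous_Xe 0 1).mul (isWeightedHomogeneous_del 0 2)) (by decide)
  · exact of_eq 1 ((isWeightedHomogeneous_Xe 0 2).mul (isWeightedHomogeneous_del 0 1)) (by decide)
  · change InQ n (gamma1 n hn)
    rw [gamma1, Matrix.det_fin_three]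
    simp only [Matrix.of_apply]
    have hm (a b c i j k : Fin 3) (h : (Pi.single i 1 + Pi.single j 1 + Pi.single k 1 :
        Fin 3 → ℕ) = fun _ => 1) : Xe n hn a i * Xe n hn b j * Xe n hn c k ∈ algQ n :=
      of_eq 1 (X3 a b c i j k) h
    exact sub_mem (add_mem (add_mem (sub_mem (sub_mem (hm _ _ _ _ _ _ (by decide))
      (hm _ _ _ _ _ _ (by decide))) (hm _ _ _ _ _ _ (by decide))) (hm _ _ _ _ _ _ (by decide)))
      (hm _ _ _ _ _ _ (by decide))) (hm _ _ _ _ _ _ (by decide))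
  · exact of_eq 2 (((isWeightedHomogeneous_del 0 1).mul (isWeightedHomogeneous_del 0 2)).mul
      (isWeightedHomogeneous_del 1 2)) (by decide)

theorem matAct_Xe {g : Matrix (Fin n) (Fin n) ℂ} (hg : IsUpperUni n g) (i j : Fin 3) :
    matAct n g (Xe n hn i j) =
      ∑ s : Fin 3, C (g (Fin.castLE hn s) (Fin.castLE hn i)) * Xe n hn s j := by
  rw [Xe, matAct, aeval_X]
  refine (Fintype.sum_of_injective (Fin.castLE hn) (Fin.castLE_injective hn) _ _
    (fun s hs => ?_) fun _ => rfl).symm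
  rw [hg.2, map_zero, zero_mul]
  rw [Fin.lt_def]
  by_contra h
  exact hs ⟨⟨s, lt_of_le_of_lt (not_lt.mp h) i.isLt⟩, rfl⟩

theorem invGen_uInv (k : Fin 5) : UInv n (invGen n hn k) := by
  intro g hg
  have z10 : g (Fin.castLE hn 1) (Fin.castLE hn 0) = 0 := hg.2 _ _ (by simp [Fin.lt_def])
  have z20 : g (Fin.castLE hn 2) (Fin.castLE hn 0) = 0 := hg.2 _ _ (by simp [Fin.lt_def])
  have z21 : g (Fin.castLE hn 2) (Fin.castLE hn 1) = 0 := hg.2 _ _ (by simp [Fin.lt_def])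
  have h0 (j : Fin 3) : matAct n g (Xe n hn 0 j) = Xe n hn 0 j := by
    simp [matAct_Xe hg, Fin.sum_univ_three, hg.1, z10, z20, -Fin.castLE_zero]
  have h1 (j : Fin 3) : matAct n g (Xe n hn 1 j) =
      C (g (Fin.castLE hn 0) (Fin.castLE hn 1)) * Xe n hn 0 j + Xe n hn 1 j := by
    simp [matAct_Xe hg, Fin.sum_univ_three, hg.1, z21]
  have h2 (j : Fin 3) : matAct n g (Xe n hn 2 j) =
      C (g (Fin.castLE hn 0) (Fin.castLE hn 2)) * Xe n hn 0 j +
        C (g (Fin.castLE hn 1) (Fin.castLE hn 2)) * Xe n hn 1 j + Xe n hn 2 j := by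
    simp [matAct_Xe hg, Fin.sum_univ_three, hg.1]
  fin_cases k <;>
    simp only [invGen, Fin.zero_eta, Fin.mk_one, Fin.reduceFinMk, Matrix.cons_val, alpha1, beta2,
      beta3, gamma1, gamma2, del, Matrix.det_fin_three, Matrix.of_apply, map_mul, map_sub, map_add,
      h0, h1, h2] <;>
    ring

theorem mem_invAlg_iff {f : P n} : f ∈ invAlg n hn ↔ InQ n f ∧ UInv n f := by
  refine ⟨fun hf => ?_, fun h => mem_invAlg_of_inQ_of_uInv h.1 h.2⟩
  have hle : invAlg n hn ≤ algQ n ⊓ algU n := by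
    rw [invAlg, ← Algebra.adjoin_range_eq_range_aeval, Algebra.adjoin_le_iff]
    rintro _ ⟨k, rfl⟩
    exact ⟨invGen_inQ k, invGen_uInv k⟩
  exact hle hf

theorem R1_sup_R2 : R1 n hn ⊔ R2 n hn = invAlg n hn := by
  rw [R1, R2, ← Algebra.adjoin_union, invAlg, ← Algebra.adjoin_range_eq_range_aeval]
  refine congrArg (Algebra.adjoin ℂ) (Set.ext fun f => ?_)
  simp only [invGen, Matrix.range_cons, Matrix.range_empty, Set.mem_union, Set.mem_insert_iff,
    Set.mem_singleton_iff, Set.mem_empty_iff_false]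
  tauto

theorem range_mMap : LinearMap.range (mMap n hn) = Subalgebra.toSubmodule (invAlg n hn) := by
  have : mMap n hn =
      (Algebra.TensorProduct.productMap (R1 n hn).val (R2 n hn).val).toLinearMap :=
    TensorProduct.ext' fun _ _ => by simp [mMap]
  have h := Algebra.TensorProduct.productMap_range (R1 n hn).val (R2 n hn).val
  rw [Subalgebra.range_val, Subalgebra.range_val, R1_sup_R2] at h
  rw [this]
  exact congrArg Subalgebra.toSubmodule h

theorem permAct_Xe (σ : Equiv.Perm (Fin 3)) (i j : Fin 3) :
    permAct n σ (Xe n hn i j) = Xe n hn i (σ j) := by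
  simp [permAct, Xe]

theorem perm_fin_three_cases (σ : Equiv.Perm (Fin 3)) :
    (σ 0 = 0 ∧ σ 1 = 1 ∧ σ 2 = 2) ∨ (σ 0 = 0 ∧ σ 1 = 2 ∧ σ 2 = 1) ∨
    (σ 0 = 1 ∧ σ 1 = 0 ∧ σ 2 = 2) ∨ (σ 0 = 1 ∧ σ 1 = 2 ∧ σ 2 = 0) ∨
    (σ 0 = 2 ∧ σ 1 = 0 ∧ σ 2 = 1) ∨ (σ 0 = 2 ∧ σ 1 = 1 ∧ σ 2 = 0) := by
  revert σ
  decide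

theorem permAct_mem_of_adjoin {S : Set (P n)} {σ : Equiv.Perm (Fin 3)}
    (h : ∀ f ∈ S, permAct n σ f ∈ Algebra.adjoin ℂ S) {f : P n} (hf : f ∈ Algebra.adjoin ℂ S) :
    permAct n σ f ∈ Algebra.adjoin ℂ S := by
  have : Algebra.adjoin ℂ S ≤ (Algebra.adjoin ℂ S).comap (permAct n σ) :=
    Algebra.adjoin_le h
  exact this hf

theorem permAct_mem_R1 (σ : Equiv.Perm (Fin 3)) {f : P n} (hf : f ∈ R1 n hn) :
    permAct n σ f ∈ R1 n hn := by
  refine permAct_mem_of_adjoin ?_ hf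
  have hα : alpha1 n hn ∈ R1 n hn := Algebra.subset_adjoin (by simp)
  have hγ₁ : gamma1 n hn ∈ R1 n hn := Algebra.subset_adjoin (by simp)
  have hγ₂ : gamma2 n hn ∈ R1 n hn := Algebra.subset_adjoin (by simp)
  have key : permAct n σ (alpha1 n hn) = alpha1 n hn ∧
      ((permAct n σ (gamma1 n hn) = gamma1 n hn ∧ permAct n σ (gamma2 n hn) = gamma2 n hn) ∨
        (permAct n σ (gamma1 n hn) = -gamma1 n hn ∧
          permAct n σ (gamma2 n hn) = -gamma2 n hn)) := by
    simp only [alpha1, gamma1, gamma2, del, Matrix.det_fin_three, Matrix.of_apply, map_mul,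
      map_sub, map_add, permAct_Xe]
    rcases perm_fin_three_cases σ with h | h | h | h | h | h <;> rw [h.1, h.2.1, h.2.2] <;>
      refine ⟨by ring, ?_⟩
    · exact .inl ⟨by ring, by ring⟩
    · exact .inr ⟨by ring, by ring⟩
    · exact .inr ⟨by ring, by ring⟩
    · exact .inl ⟨by ring, by ring⟩
    · exact .inl ⟨by ring, by ring⟩
    · exact .inr ⟨by ring, by ring⟩
  rintro _ (rfl | rfl | rfl)
  · rwa [key.1]
  · rcases key.2 with h | h <;> rw [h.1]
    exacts [hγ₁, neg_mem hγ₁]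
  · rcases key.2 with h | h <;> rw [h.2]
    exacts [hγ₂, neg_mem hγ₂]

theorem permAct_mem_R2 (σ : Equiv.Perm (Fin 3)) {f : P n} (hf : f ∈ R2 n hn) :
    permAct n σ f ∈ R2 n hn := by
  refine permAct_mem_of_adjoin ?_ hf
  have hβ₂ : beta2 n hn ∈ R2 n hn := Algebra.subset_adjoin (by simp)
  have hβ₃ : beta3 n hn ∈ R2 n hn := Algebra.subset_adjoin (by simp)
  have h₂ : permAct n σ (beta2 n hn) =
      Xe n hn 0 (σ 1) * (Xe n hn 0 (σ 0) * Xe n hn 1 (σ 2) - Xe n hn 1 (σ 0) * Xe n hn 0 (σ 2)) := by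
    simp only [beta2, del, map_mul, map_sub, permAct_Xe]
  have h₃ : permAct n σ (beta3 n hn) =
      Xe n hn 0 (σ 2) * (Xe n hn 0 (σ 0) * Xe n hn 1 (σ 1) - Xe n hn 1 (σ 0) * Xe n hn 0 (σ 1)) := by
    simp only [beta3, del, map_mul, map_sub, permAct_Xe]
  have key : (permAct n σ (beta2 n hn) = beta2 n hn ∧ permAct n σ (beta3 n hn) = beta3 n hn) ∨
      (permAct n σ (beta2 n hn) = beta3 n hn ∧ permAct n σ (beta3 n hn) = beta2 n hn) ∨
      (permAct n σ (beta2 n hn) = beta2 n hn - beta3 n hn ∧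
        permAct n σ (beta3 n hn) = -beta3 n hn) ∨
      (permAct n σ (beta2 n hn) = -beta3 n hn ∧
        permAct n σ (beta3 n hn) = beta2 n hn - beta3 n hn) ∨
      (permAct n σ (beta2 n hn) = beta3 n hn - beta2 n hn ∧
        permAct n σ (beta3 n hn) = -beta2 n hn) ∨
      (permAct n σ (beta2 n hn) = -beta2 n hn ∧
        permAct n σ (beta3 n hn) = beta3 n hn - beta2 n hn) := by
    rw [h₂, h₃]
    simp only [beta2, beta3, del]
    rcases perm_fin_three_cases σ with h | h | h | h | h | h <;> rw [h.1, h.2.1, h.2.2]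
    · exact .inl ⟨by ring, by ring⟩
    · exact .inr (.inl ⟨by ring, by ring⟩)
    · exact .inr (.inr (.inl ⟨by ring, by ring⟩))
    · exact .inr (.inr (.inr (.inl ⟨by ring, by ring⟩)))
    · exact .inr (.inr (.inr (.inr (.inl ⟨by ring, by ring⟩))))
    · exact .inr (.inr (.inr (.inr (.inr ⟨by ring, by ring⟩))))
  rintro _ (rfl | rfl)
  · rcases key with h | h | h | h | h | h <;> rw [h.1]
    exacts [hβ₂, hβ₃, sub_mem hβ₂ hβ₃, neg_mem hβ₃, sub_mem hβ₃ hβ₂, neg_mem hβ₂]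
  · rcases key with h | h | h | h | h | h <;> rw [h.2]
    exacts [hβ₃, hβ₂, neg_mem hβ₃, sub_mem hβ₂ hβ₃, neg_mem hβ₂, sub_mem hβ₃ hβ₂]

/-- The diagonal action of `σ ∈ S₃` on `R₁ ⊗ R₂`. -/
def tenActR (hn : 3 ≤ n) (σ : Equiv.Perm (Fin 3)) :
    R1 n hn ⊗[ℂ] R2 n hn →ₗ[ℂ] R1 n hn ⊗[ℂ] R2 n hn :=
  TensorProduct.map
    (((permAct n σ).comp (R1 n hn).val).codRestrict (R1 n hn)
      fun f => permAct_mem_R1 σ f.2).toLinearMap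
    (((permAct n σ).comp (R2 n hn).val).codRestrict (R2 n hn)
      fun f => permAct_mem_R2 σ f.2).toLinearMap

theorem iotaMap_tenActR (σ : Equiv.Perm (Fin 3)) (t : R1 n hn ⊗[ℂ] R2 n hn) :
    iotaMap n hn (tenActR hn σ t) = tenAct n σ (iotaMap n hn t) := by
  have : iotaMap n hn ∘ₗ tenActR hn σ = tenAct n σ ∘ₗ iotaMap n hn :=
    TensorProduct.ext' fun _ _ => rfl
  exact LinearMap.congr_fun this t

theorem permAct_permAct (τ σ : Equiv.Perm (Fin 3)) (f : P n) :
    permAct n τ (permAct n σ f) = permAct n (τ * σ) f := by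
  have : (permAct n τ).comp (permAct n σ) = permAct n (τ * σ) := by
    apply MvPolynomial.algHom_ext
    intro p
    simp [permAct]
  exact DFunLike.congr_fun this f

theorem tenAct_tenAct (τ σ : Equiv.Perm (Fin 3)) (t : P n ⊗[ℂ] P n) :
    tenAct n τ (tenAct n σ t) = tenAct n (τ * σ) t := by
  have : tenAct n τ ∘ₗ tenAct n σ = tenAct n (τ * σ) := by
    refine TensorProduct.ext' fun f g => ?_
    simp [tenAct, permAct_permAct]
  exact LinearMap.congr_fun this t

theorem mul'_tenAct (σ : Equiv.Perm (Fin 3)) (t : P n ⊗[ℂ] P n) :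
    LinearMap.mul' ℂ (P n) (tenAct n σ t) = permAct n σ (LinearMap.mul' ℂ (P n) t) := by
  have : LinearMap.mul' ℂ (P n) ∘ₗ tenAct n σ =
      (permAct n σ).toLinearMap ∘ₗ LinearMap.mul' ℂ (P n) :=
    TensorProduct.ext' fun _ _ => by simp [tenAct]
  exact LinearMap.congr_fun this t

theorem mMap_apply (t : R1 n hn ⊗[ℂ] R2 n hn) :
    mMap n hn t = LinearMap.mul' ℂ (P n) (iotaMap n hn t) :=
  rfl

/-- The average of an element of `R₁ ⊗ R₂` over `S₃`. -/
def symmetrize (t : R1 n hn ⊗[ℂ] R2 n hn) : R1 n hn ⊗[ℂ] R2 n hn :=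
  (Fintype.card (Equiv.Perm (Fin 3)) : ℂ)⁻¹ • ∑ σ, tenActR hn σ t

theorem tenAct_iotaMap_symmetrize (τ : Equiv.Perm (Fin 3)) (t : R1 n hn ⊗[ℂ] R2 n hn) :
    tenAct n τ (iotaMap n hn (symmetrize t)) = iotaMap n hn (symmetrize t) := by
  simp only [symmetrize, map_smul, map_sum, iotaMap_tenActR, tenAct_tenAct]
  exact congrArg _ (Fintype.sum_equiv (Equiv.mulLeft τ) _ _ fun _ => rfl)

theorem mMap_symmetrize {t : R1 n hn ⊗[ℂ] R2 n hn}
    (ht : ∀ σ, permAct n σ (mMap n hn t) = mMap n hn t) :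
    mMap n hn (symmetrize t) = mMap n hn t := by
  have h (σ : Equiv.Perm (Fin 3)) : mMap n hn (tenActR hn σ t) = mMap n hn t := by
    rw [mMap_apply, iotaMap_tenActR, mul'_tenAct, ← mMap_apply, ht]
  rw [symmetrize, map_smul, map_sum, Finset.sum_congr rfl fun σ _ => h σ, Finset.sum_const,
    Finset.card_univ]
  rw [← Nat.cast_smul_eq_nsmul ℂ, smul_smul, inv_mul_cancel₀ (by simp [Fintype.card_ne_zero]),
    one_smul]

end InvariantAlgebra

/-- `R₁` and `R₂` are `S₃`-stable, `m : R₁ ⊗ R₂ → Q^{U_n}` is a surjective `S₃`-equivariant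
linear map (where `S₃` acts diagonally on `R₁ ⊗ R₂`), and
`m((R₁ ⊗ R₂)^{S₃}) = (Q^{U_n})^{S₃}`. An element `t ∈ R₁ ⊗ R₂` is `S₃`-invariant iff its
image in `𝒫 ⊗ 𝒫` under the canonical injection is invariant under the diagonal action. -/
theorem stmt_13 (n : ℕ) (hn : 3 ≤ n) :
    (∀ σ : Equiv.Perm (Fin 3), ∀ f ∈ R1 n hn, permAct n σ f ∈ R1 n hn) ∧
    (∀ σ : Equiv.Perm (Fin 3), ∀ f ∈ R2 n hn, permAct n σ f ∈ R2 n hn) ∧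
    (∀ (f : R1 n hn) (g : R2 n hn), mMap n hn (f ⊗ₜ[ℂ] g) = (f : P n) * (g : P n)) ∧
    ((LinearMap.range (mMap n hn) : Set (P n)) = {f : P n | InQ n f ∧ UInv n f}) ∧
    (∀ σ : Equiv.Perm (Fin 3),
      (permAct n σ).toLinearMap ∘ₗ mMap n hn =
        LinearMap.mul' ℂ (P n) ∘ₗ tenAct n σ ∘ₗ iotaMap n hn) ∧
    ((mMap n hn) '' {t : R1 n hn ⊗[ℂ] R2 n hn |
        ∀ σ : Equiv.Perm (Fin 3), tenAct n σ (iotaMap n hn t) = iotaMap n hn t} =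
      {f : P n | InQ n f ∧ UInv n f ∧ ∀ σ : Equiv.Perm (Fin 3), permAct n σ f = f}) := by
  have hrange (f : P n) : f ∈ LinearMap.range (mMap n hn) ↔ InQ n f ∧ UInv n f := by
    rw [range_mMap, Subalgebra.mem_toSubmodule, mem_invAlg_iff]
  refine ⟨fun σ f hf => permAct_mem_R1 σ hf, fun σ f hf => permAct_mem_R2 σ hf, fun f g => rfl,
    Set.ext hrange, fun σ => LinearMap.ext fun t => (mul'_tenAct σ (iotaMap n hn t)).symm, ?_⟩
  ext f
  constructor
  · rintro ⟨t, ht, rfl⟩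
    obtain ⟨hQ, hU⟩ := (hrange _).mp ⟨t, rfl⟩
    refine ⟨hQ, hU, fun σ => ?_⟩
    rw [mMap_apply, ← mul'_tenAct, ht σ]
  · rintro ⟨hQ, hU, hf⟩
    obtain ⟨t, rfl⟩ := (hrange f).mpr ⟨hQ, hU⟩
    exact ⟨symmetrize t, fun σ => tenAct_iotaMap_symmetrize σ t, mMap_symmetrize hf⟩
end
end

section
/- Let λ₁ ≥ λ₂ ≥ λ₃ ≥ 0 be integers with λ₁ + λ₂ + λ₃ divisible by 3. Then the number of tuples (a, b, c, d, e, ε) with a, b, d, e ∈ ℤ_{≥0} and c, ε ∈ {0,1} satisfying the system 3a + 4b + 6c + g + 3h = λ₁, 2b + 3c + g + 3h = λ₂, and g = λ₃, where g = 2d + ε and h = 2e + (1 − ε), equals ⌊(min{λ₁ − λ₂, λ₂ − λ₃} + 2λ₁ + λ₂ + 3)/6⌋ + ⌊(λ₂ + 1)/2⌋ + ⌊−(λ₁ + 2λ₂)/3⌋. -/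
/-- The number of tuples `(a, b, c, d, e, ε)` with `a, b, d, e ∈ ℤ_{≥0}` and `c, ε ∈ {0,1}`
satisfying `3a + 4b + 6c + g + 3h = λ₁`, `2b + 3c + g + 3h = λ₂`, `g = λ₃`, where
`g = 2d + ε` and `h = 2e + (1 − ε)`, equals
`⌊(min{λ₁−λ₂, λ₂−λ₃} + 2λ₁ + λ₂ + 3)/6⌋ + ⌊(λ₂+1)/2⌋ + ⌊−(λ₁+2λ₂)/3⌋`. -/
theorem stmt_19 (l1 l2 l3 : ℤ) (h12 : l2 ≤ l1) (h23 : l3 ≤ l2) (h3 : 0 ≤ l3)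
    (hdvd : (3 : ℤ) ∣ l1 + l2 + l3) :
    (Nat.card {p : ℕ × ℕ × Fin 2 × ℕ × ℕ × Fin 2 //
        match p with
        | (a, b, c, d, e, ε) =>
          3 * (a : ℤ) + 4 * (b : ℤ) + 6 * ((c : ℕ) : ℤ) +
              (2 * (d : ℤ) + ((ε : ℕ) : ℤ)) +
              3 * (2 * (e : ℤ) + ((1 - (ε : ℕ) : ℕ) : ℤ)) = l1 ∧
          2 * (b : ℤ) + 3 * ((c : ℕ) : ℤ) +
              (2 * (d : ℤ) + ((ε : ℕ) : ℤ)) +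
              3 * (2 * (e : ℤ) + ((1 - (ε : ℕ) : ℕ) : ℤ)) = l2 ∧
          2 * (d : ℤ) + ((ε : ℕ) : ℤ) = l3} : ℤ) =
      ⌊((min (l1 - l2) (l2 - l3) + 2 * l1 + l2 + 3 : ℤ) : ℚ) / 6⌋ +
        ⌊((l2 + 1 : ℤ) : ℚ) / 2⌋ + ⌊((-(l1 + 2 * l2) : ℤ) : ℚ) / 3⌋ := by
  have hfl (x : ℤ) (n : ℕ) : ⌊(x : ℚ) / (n : ℚ)⌋ = x / (n : ℤ) := Rat.floor_intCast_div_natCast x n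
  have hfl6 := hfl (min (l1 - l2) (l2 - l3) + 2 * l1 + l2 + 3) 6
  have hfl2 := hfl (l2 + 1) 2
  have hfl3 := hfl (-(l1 + 2 * l2)) 3
  push_cast only [Nat.cast_ofNat] at hfl6 hfl2 hfl3
  rw [hfl6, hfl2, hfl3]
  obtain ⟨M, hM⟩ : ∃ M, M = min (l1 - l2) (l2 - l3) := ⟨_, rfl⟩
  rw [← hM]
  obtain ⟨N, hN⟩ : ∃ N : ℕ, (N : ℤ) =
      (M + 2 * l1 + l2 + 3) / 6 + (l2 + 1) / 2 + -(l1 + 2 * l2) / 3 :=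
    ⟨_, Int.toNat_of_nonneg (by omega)⟩
  rw [← hN, Nat.cast_inj]
  refine (Nat.card_congr (Equiv.ofBijective (fun p => (⟨p.1.2.1 / 3, ?_⟩ : Fin N)) ⟨?_, ?_⟩)).trans
    (Nat.card_fin N)
  · obtain ⟨⟨a, b, c, d, e, ε⟩, h1, h2, h3⟩ := p
    fin_cases c <;> fin_cases ε <;> simp at h1 h2 h3 ⊢ <;> omega
  · rintro ⟨⟨a, b, c, d, e, ε⟩, h1, h2, h3⟩ ⟨⟨a', b', c', d', e', ε'⟩, h1', h2', h3'⟩ h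
    simp only [Subtype.mk.injEq, Prod.mk.injEq, Fin.ext_iff] at h ⊢
    have := c.2
    have := c'.2
    have := ε.2
    have := ε'.2
    omega
  · rintro ⟨t, ht⟩
    obtain ⟨r, hr, hr1, hr2, hr3⟩ : ∃ r : ℕ, (r ≤ 5 ∧ r ≠ 1 ∨ r = 7) ∧
        (2 : ℤ) ∣ l2 + 1 - r ∧ (3 : ℤ) ∣ l2 - l3 - r ∧ 6 * t + r ≤ M := by
      by_cases h1 : (2 : ℤ) ∣ l2 ∧ (3 : ℤ) ∣ l2 - l3 - 1
      · exact ⟨7, by omega, by omega, by omega, by omega⟩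
      · refine ⟨((3 * (l2 + 1) + 4 * (l2 - l3)) % 6).toNat, ?_, ?_, ?_, ?_⟩ <;> omega
    obtain ⟨a, ha⟩ : ∃ a : ℕ, 3 * (a : ℤ) = l1 - l2 - (6 * t + r) :=
      ⟨((l1 - l2 - (6 * t + r)) / 3).toNat, by omega⟩
    obtain ⟨h, hh⟩ : ∃ h : ℕ, 3 * (h : ℤ) = l2 - l3 - (6 * t + r) :=
      ⟨((l2 - l3 - (6 * t + r)) / 3).toNat, by omega⟩
    refine ⟨⟨(a, 3 * t + (r - 3 * (r % 2)) / 2, ⟨r % 2, by omega⟩, l3.toNat / 2, h / 2,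
      ⟨l3.toNat % 2, by omega⟩), ?_, ?_, ?_⟩, ?_⟩
    · dsimp only
      omega
    · dsimp only
      omega
    · dsimp only
      omega
    · simp only [Fin.mk.injEq]
      omega
end
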